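/- arXiv:1901.03996 — 5 statements merged into one kernel-verified Lean document; each statement's English description precedes it below -/
import Mathlib

section
/- Let f(z,w) = a₀(z) + a₁(z)w + ⋯ + aₙ(z)wⁿ with polynomial coefficients aᵢ and n ≥ 1. If z₀, w₀ ∈ ℂ satisfy f(z₀, w₀) = 0 and f_w(z₀, w₀) ≠ 0, then there exist an open neighborhood U of z₀ and a function g analytic on U such that g(z₀) = w₀ and f(z, g(z)) = 0 for all z ∈ U. (This is the local existence of an analytic branch of the algebraic function defined by f = 0.) -/
open scoped Topology

/-- Implicit function theorem for a scalar function of two scalar variables, with the branch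
differentiable on an open neighborhood of the base point. -/
theorem exists_isOpen_differentiableOn_implicit {𝕜 : Type*} [RCLike 𝕜]
    {F : 𝕜 × 𝕜 → 𝕜} {x₀ y₀ d : 𝕜}
    (hF : ContDiffAt 𝕜 1 F (x₀, y₀)) (hd : HasDerivAt (fun y => F (x₀, y)) d y₀) (hd0 : d ≠ 0) :
    ∃ U : Set 𝕜, IsOpen U ∧ x₀ ∈ U ∧
      ∃ g : 𝕜 → 𝕜, DifferentiableOn 𝕜 g U ∧ g x₀ = y₀ ∧ ∀ x ∈ U, F (x, g x) = F (x₀, y₀) := by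
  have hinv : (fderiv 𝕜 F (x₀, y₀) ∘L .inr 𝕜 𝕜 𝕜).IsInvertible := by
    refine ⟨ContinuousLinearEquiv.unitsEquivAut 𝕜 (Units.mk0 d hd0), ?_⟩
    have hcomp : HasFDerivAt (fun y => F (x₀, y)) (fderiv 𝕜 F (x₀, y₀) ∘L .inr 𝕜 𝕜 𝕜) y₀ :=
      (hF.differentiableAt one_ne_zero).hasFDerivAt.comp y₀ (hasFDerivAt_prodMk_right x₀ y₀)
    rw [hcomp.unique hd.hasFDerivAt]
    ext
    simp
  have hg := hF.contDiffAt_implicitFunction one_ne_zero hinv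
  have hdiff : ∀ᶠ x in 𝓝 x₀, DifferentiableAt 𝕜 (hF.implicitFunction one_ne_zero hinv) x :=
    (hg.eventually (by simp)).mono fun x hx => hx.differentiableAt one_ne_zero
  obtain ⟨U, hU, hUo, hxU⟩ := eventually_nhds_iff.mp
    (hdiff.and (hF.eventually_apply_implicitFunction one_ne_zero hinv))
  exact ⟨U, hUo, hxU, hF.implicitFunction one_ne_zero hinv,
    fun x hx => (hU x hx).1.differentiableWithinAt,
    hF.implicitFunction_apply_self one_ne_zero hinv, fun x hx => (hU x hx).2⟩

/-- **Local existence of an analytic branch of an algebraic function.**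
If `f(z,w) = a₀(z) + a₁(z)w + ⋯ + aₙ(z)wⁿ` with polynomial coefficients, `n ≥ 1`,
`f(z₀,w₀) = 0` and `f_w(z₀,w₀) ≠ 0`, then there is an open neighborhood `U` of `z₀`
and a function `g` analytic (complex-differentiable) on `U` with `g z₀ = w₀` and
`f(z, g z) = 0` on `U`. -/
theorem local_analytic_branch
    (n : ℕ) (hn : 1 ≤ n) (a : ℕ → Polynomial ℂ)
    (f fw : ℂ → ℂ → ℂ)
    (hf : ∀ z w : ℂ, f z w = ∑ i ∈ Finset.range (n + 1), (a i).eval z * w ^ i)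
    (hfw : ∀ z w : ℂ, fw z w = ∑ i ∈ Finset.range (n + 1), (a i).eval z * (i : ℂ) * w ^ (i - 1))
    (z₀ w₀ : ℂ) (hzero : f z₀ w₀ = 0) (hw : fw z₀ w₀ ≠ 0) :
    ∃ U : Set ℂ, IsOpen U ∧ z₀ ∈ U ∧
      ∃ g : ℂ → ℂ, DifferentiableOn ℂ g U ∧ g z₀ = w₀ ∧ ∀ z ∈ U, f z (g z) = 0 := by
  have hF : ContDiff ℂ 1 fun p : ℂ × ℂ => f p.1 p.2 := by
    simp only [hf]
    refine ContDiff.sum fun i _ => ContDiff.mul ?_ (contDiff_snd.pow i)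
    simpa [Function.comp_def] using
      ((a i).contDiff_aeval 1).comp (contDiff_fst (𝕜 := ℂ) (E := ℂ) (F := ℂ))
  have hd : HasDerivAt (fun w => f z₀ w) (fw z₀ w₀) w₀ := by
    simp only [hf, hfw, mul_assoc]
    exact HasDerivAt.fun_sum fun i _ => (hasDerivAt_pow i w₀).const_mul _
  obtain ⟨U, hUo, hzU, g, hg, hgz, hfg⟩ :=
    exists_isOpen_differentiableOn_implicit hF.contDiffAt hd hw
  exact ⟨U, hUo, hzU, g, hg, hgz, fun z hz => (hfg z hz).trans hzero⟩
end

section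
/- Let f(z,w) = a₀(z) + a₁(z)w + ⋯ + aₙ(z)wⁿ with polynomial coefficients aᵢ and n ≥ 1, and let z₀ ∈ ℂ with aₙ(z₀) ≠ 0 be such that f(z₀,·) has n distinct roots w₁, …, wₙ. Then there exist an open neighborhood U of z₀ and functions g₁, …, gₙ analytic on U such that gᵢ(z₀) = wᵢ and f(z, gᵢ(z)) = 0 for all z ∈ U and all i, and for every z ∈ U the values g₁(z), …, gₙ(z) are pairwise distinct and are exactly the roots of the polynomial f(z,·). (The n coverings of the algebraic function near a non-singular point.) -/
open Polynomial Filter Topology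

/-- A polynomial of degree `n` vanishing at `n` distinct points has exactly these points as its
roots. -/
theorem roots_eq_map_of_injective {R : Type*} [CommRing R] [IsDomain R] {n : ℕ} {p : R[X]}
    (hp : p ≠ 0) (hdeg : p.natDegree ≤ n) {w : Fin n → R} (hw : Function.Injective w)
    (hroot : ∀ i, p.IsRoot (w i)) : p.roots = Finset.univ.val.map w := by
  refine (Multiset.eq_of_le_of_card_le ?_ ?_).symm
  · rw [Multiset.le_iff_subset (Finset.univ.nodup.map hw)]
    intro x hx
    obtain ⟨i, -, rfl⟩ := Multiset.mem_map.mp hx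
    exact (mem_roots hp).mpr (hroot i)
  · simpa using (card_roots' p).trans hdeg

theorem derivative_eval_ne_zero_of_nodup_roots {R : Type*} [CommRing R] [IsDomain R] {p : R[X]}
    (hp : p ≠ 0) (hnodup : p.roots.Nodup) {x : R} (hx : p.IsRoot x) :
    p.derivative.eval x ≠ 0 := by
  classical
  intro h
  have hlt := (one_lt_rootMultiplicity_iff_isRoot hp).mpr ⟨hx, h⟩
  rw [← count_roots] at hlt
  exact hlt.not_ge (Multiset.nodup_iff_count_le_one.mp hnodup x)

/-- The implicit function theorem for a scalar equation, with the partial derivative in the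
dependent variable given as a derivative in one variable. -/
theorem exists_implicit_of_deriv_ne_zero {𝕜 : Type*} [RCLike 𝕜] {F : 𝕜 × 𝕜 → 𝕜} {z₀ w₀ c : 𝕜}
    (hF : ContDiffAt 𝕜 1 F (z₀, w₀)) (hderiv : HasDerivAt (fun w => F (z₀, w)) c w₀) (hc : c ≠ 0) :
    ∃ g : 𝕜 → 𝕜, g z₀ = w₀ ∧ (∀ᶠ z in 𝓝 z₀, DifferentiableAt 𝕜 g z) ∧
      ∀ᶠ z in 𝓝 z₀, F (z, g z) = F (z₀, w₀) := by
  have hinr : HasFDerivAt (fun w => F (z₀, w))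
      (fderiv 𝕜 F (z₀, w₀) ∘L .inr 𝕜 𝕜 𝕜) w₀ :=
    (hF.differentiableAt one_ne_zero).hasFDerivAt.comp w₀ (hasFDerivAt_prodMk_right z₀ w₀)
  have hinv : (fderiv 𝕜 F (z₀, w₀) ∘L .inr 𝕜 𝕜 𝕜).IsInvertible := by
    rw [hinr.unique hderiv.hasFDerivAt]
    exact ⟨ContinuousLinearEquiv.unitsEquivAut 𝕜 (Units.mk0 c hc), by ext; simp⟩
  refine ⟨hF.implicitFunction one_ne_zero hinv, hF.implicitFunction_apply_self _ _, ?_,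
    hF.eventually_apply_implicitFunction _ _⟩
  filter_upwards [(hF.contDiffAt_implicitFunction one_ne_zero hinv).eventually (by simp)] with z hz
  exact hz.differentiableAt one_ne_zero


/-- **The `n` coverings of the algebraic function near a non-singular point.**
If `aₙ(z₀) ≠ 0` and `f(z₀,·)` has `n` distinct roots `w₁,…,wₙ`, then on some open
neighborhood `U` of `z₀` there are analytic functions `g₁,…,gₙ` with `gᵢ z₀ = wᵢ`,
`f(z, gᵢ z) = 0`, and for every `z ∈ U` the values `g₁ z, …, gₙ z` are pairwise
distinct and are exactly the roots of `f(z,·)`. -/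
theorem n_coverings_near_nonsingular_point
    (n : ℕ) (hn : 1 ≤ n) (a : ℕ → Polynomial ℂ)
    (f : ℂ → ℂ → ℂ)
    (hf : ∀ z w : ℂ, f z w = ∑ i ∈ Finset.range (n + 1), (a i).eval z * w ^ i)
    (z₀ : ℂ) (han : (a n).eval z₀ ≠ 0)
    (w : Fin n → ℂ) (hwinj : Function.Injective w)
    (hwroot : ∀ i : Fin n, f z₀ (w i) = 0) :
    ∃ U : Set ℂ, IsOpen U ∧ z₀ ∈ U ∧
      ∃ g : Fin n → ℂ → ℂ,
        (∀ i, DifferentiableOn ℂ (g i) U) ∧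
        (∀ i, g i z₀ = w i) ∧
        (∀ i, ∀ z ∈ U, f z (g i z) = 0) ∧
        (∀ z ∈ U, Function.Injective fun i => g i z) ∧
        (∀ z ∈ U, ∀ u : ℂ, f z u = 0 ↔ ∃ i, u = g i z) := by
  let P : ℂ → ℂ[X] := fun z => ∑ i ∈ Finset.range (n + 1), C ((a i).eval z) * X ^ i
  have hPeval : ∀ z u, (P z).eval u = f z u := fun z u => by
    simp [P, hf, eval_finsetSum]
  have hPdeg : ∀ z, (P z).natDegree ≤ n := fun z =>
    natDegree_sum_le_of_forall_le _ _ fun i hi =>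
      (natDegree_C_mul_X_pow_le _ _).trans (Nat.lt_succ_iff.mp (Finset.mem_range.mp hi))
  have hPne : ∀ z, (a n).eval z ≠ 0 → P z ≠ 0 := fun z hz h => by
    have hcoeff : (P z).coeff n = (a n).eval z := by simp [P, coeff_X_pow]
    exact hz (by rw [← hcoeff, h, coeff_zero])
  have hroots : ∀ z, (a n).eval z ≠ 0 → ∀ v : Fin n → ℂ, Function.Injective v →
      (∀ i, f z (v i) = 0) → (P z).roots = Finset.univ.val.map v := fun z hz v hv h =>
    roots_eq_map_of_injective (hPne z hz) (hPdeg z) hv fun i => (hPeval z _).trans (h i)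
  have hF : ContDiff ℂ 1 fun p : ℂ × ℂ => f p.1 p.2 := by
    simp only [hf]
    exact ContDiff.sum fun i _ => (((a i).contDiff_aeval 1).comp contDiff_fst).mul (contDiff_snd.pow i)
  have hsimple : ∀ i, (P z₀).derivative.eval (w i) ≠ 0 := fun i =>
    derivative_eval_ne_zero_of_nodup_roots (hPne z₀ han)
      (hroots z₀ han w hwinj hwroot ▸ Finset.univ.nodup.map hwinj)
      ((hPeval z₀ _).trans (hwroot i))
  have hgerm : ∀ i, ∃ g : ℂ → ℂ, g z₀ = w i ∧ (∀ᶠ z in 𝓝 z₀, DifferentiableAt ℂ g z) ∧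
      ∀ᶠ z in 𝓝 z₀, f z (g z) = f z₀ (w i) := fun i =>
    exists_implicit_of_deriv_ne_zero (F := fun p => f p.1 p.2) hF.contDiffAt
      (by simpa only [hPeval] using (P z₀).hasDerivAt (w i)) (hsimple i)
  choose g hg₀ hgdiff hgroot using hgerm
  have hgcont : ∀ i, ContinuousAt (g i) z₀ := fun i => (hgdiff i).self_of_nhds.continuousAt
  have hginj : ∀ᶠ z in 𝓝 z₀, ∀ i j, i ≠ j → g i z ≠ g j z := by
    simp only [eventually_all]
    intro i j hij
    refine ((hgcont i).ne_iff_eventually_ne (hgcont j)).mp ?_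
    rw [hg₀, hg₀]
    exact hwinj.ne hij
  have hlead : ∀ᶠ z in 𝓝 z₀, (a n).eval z ≠ 0 :=
    (a n).continuous.continuousAt.eventually_ne han
  obtain ⟨U, hU, hUo, hzU⟩ := eventually_nhds_iff.mp
    ((eventually_all.mpr hgdiff).and ((eventually_all.mpr hgroot).and (hginj.and hlead)))
  have hroot : ∀ z ∈ U, ∀ i, f z (g i z) = 0 := fun z hz i =>
    ((hU z hz).2.1 i).trans (hwroot i)
  have hinj : ∀ z ∈ U, Function.Injective fun i => g i z := fun z hz i j hij =>
    not_imp_not.mp ((hU z hz).2.2.1 i j) hij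
  refine ⟨U, hUo, hzU, g, fun i z hz => ((hU z hz).1 i).differentiableWithinAt, hg₀,
    fun i z hz => hroot z hz i, hinj, fun z hz u => ?_⟩
  have hlz := (hU z hz).2.2.2
  rw [← hPeval, ← IsRoot.def, ← mem_roots (hPne z hlz),
    hroots z hlz _ (hinj z hz) (hroot z hz)]
  simp [eq_comm]
end

section
/- Let f(z,w) = a₀(z) + a₁(z)w + ⋯ + aₙ(z)wⁿ with polynomial coefficients aᵢ and n ≥ 1, and let S be the singular set of f. Let γ : [0,1] → ℂ be a continuous path with γ(t) ∉ S for all t, and let w₀ ∈ ℂ be a root of f(γ(0),·). Then there exists a unique continuous function w : [0,1] → ℂ with w(0) = w₀ and f(γ(t), w(t)) = 0 for all t ∈ [0,1]. (Existence and uniqueness of analytic continuation of a branch sheet along a path avoiding the singular points.) -/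
open Filter Topology in
/-- If `f` has invertible partial derivative in the second variable at each of its zeros lying
over `γ`, then the pullback of the zero locus of `f` along `γ` is a local homeomorphism
over the base. -/
theorem isLocalHomeomorph_fst_zeroLocus {𝕜 T E₁ E₂ F : Type*} [RCLike 𝕜] [TopologicalSpace T]
    [NormedAddCommGroup E₁] [NormedSpace 𝕜 E₁] [CompleteSpace E₁]
    [NormedAddCommGroup E₂] [NormedSpace 𝕜 E₂] [CompleteSpace E₂]
    [NormedAddCommGroup F] [NormedSpace 𝕜 F] [CompleteSpace F]
    {f : E₁ × E₂ → F} (hf : ContDiff 𝕜 1 f) {γ : T → E₁} (hγ : Continuous γ)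
    (hinv : ∀ t w, f (γ t, w) = 0 → (fderiv 𝕜 f (γ t, w) ∘L .inr 𝕜 E₁ E₂).IsInvertible) :
    IsLocalHomeomorph (fun e : {e : T × E₂ // f (γ e.1, e.2) = 0} ↦ e.1.1) := by
  have hcont : Continuous (fun e : {e : T × E₂ // f (γ e.1, e.2) = 0} ↦ e.1.1) := by fun_prop
  have hpair : Continuous (fun e : T × E₂ ↦ (γ e.1, e.2)) := by fun_prop
  have key : ∀ e : {e : T × E₂ // f (γ e.1, e.2) = 0}, ∃ ψ : E₁ → E₂,
      (∀ᶠ x in 𝓝 (γ e.1.1), f (x, ψ x) = 0) ∧ Tendsto ψ (𝓝 (γ e.1.1)) (𝓝 e.1.2) ∧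
      ∀ᶠ v in 𝓝 (γ e.1.1, e.1.2), f v = 0 → ψ v.1 = v.2 := by
    intro e
    have hd := (hf.contDiffAt (x := (γ e.1.1, e.1.2))).hasStrictFDerivAt one_ne_zero
    have hi := hinv _ _ e.2
    refine ⟨hd.implicitFunctionOfProdDomain hi, ?_, hd.tendsto_implicitFunctionOfProdDomain hi, ?_⟩
    · simpa only [e.2] using hd.eventually_apply_implicitFunctionOfProdDomain hi
    · filter_upwards [hd.eventually_apply_eq_iff_implicitFunctionOfProdDomain hi] with v hv h
      exact hv.mp (h.trans e.2.symm)
  have hopen : IsOpenMap (fun e : {e : T × E₂ // f (γ e.1, e.2) = 0} ↦ e.1.1) := by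
    refine isOpenMap_iff_nhds_le.mpr fun e s hs ↦ ?_
    obtain ⟨ψ, hzero, htend, -⟩ := key e
    obtain ⟨V, hV, hVs⟩ := mem_nhds_subtype _ _ _ |>.mp (mem_map.mp hs)
    have hsec : Tendsto (fun t ↦ (t, ψ (γ t))) (𝓝 e.1.1) (𝓝 e.1) :=
      tendsto_id.prodMk_nhds (htend.comp hγ.continuousAt)
    filter_upwards [hsec hV, hγ.continuousAt.eventually hzero] with t htV ht
    exact hVs (a := ⟨(t, ψ (γ t)), ht⟩) htV
  refine isLocalHomeomorph_iff_isOpenEmbedding_restrict.mpr fun e ↦ ?_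
  obtain ⟨ψ, -, -, hψ⟩ := key e
  have hU := (hpair.comp continuous_subtype_val).continuousAt (x := e) |>.eventually hψ
  obtain ⟨U, hUψ, hUo, heU⟩ := eventually_nhds_iff.mp hU
  refine ⟨U, hUo.mem_nhds heU, .of_continuous_injective_isOpenMap
    (hcont.comp continuous_subtype_val) ?_ (hopen.comp hUo.isOpenMap_subtype_val)⟩
  rintro ⟨⟨⟨t, w⟩, h₁⟩, hw⟩ ⟨⟨⟨t', w'⟩, h₂⟩, hw'⟩ (rfl : t = t')
  obtain rfl : w = w' := (hUψ _ hw h₁).symm.trans (hUψ _ hw' h₂)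
  rfl

/-- A bound for the roots of a polynomial in terms of its coefficients. -/
theorem norm_le_max_of_sum_mul_pow_eq_zero {K : Type*} [NormedField K] {n : ℕ} {c : ℕ → K} {w : K}
    (hc : c n ≠ 0) (h : ∑ i ∈ Finset.range (n + 1), c i * w ^ i = 0) :
    ‖w‖ ≤ max 1 ((∑ i ∈ Finset.range n, ‖c i‖) / ‖c n‖) := by
  rcases le_total ‖w‖ 1 with hw | hw
  · exact le_max_of_le_left hw
  refine le_max_of_le_right ?_
  rw [Finset.sum_range_succ] at h
  rcases n with _ | m
  · simp [hc] at h
  rw [le_div_iff₀ (norm_pos_iff.mpr hc)]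
  refine le_of_mul_le_mul_right ?_ (pow_pos (one_pos.trans_le hw) m)
  calc ‖w‖ * ‖c (m + 1)‖ * ‖w‖ ^ m = ‖c (m + 1) * w ^ (m + 1)‖ := by
        rw [norm_mul, norm_pow]; ring
    _ = ‖∑ i ∈ Finset.range (m + 1), c i * w ^ i‖ := by
        rw [eq_neg_of_add_eq_zero_left h, norm_neg]
    _ ≤ ∑ i ∈ Finset.range (m + 1), ‖c i‖ * ‖w‖ ^ m := by
        refine norm_sum_le_of_le _ fun i hi ↦ ?_
        rw [norm_mul, norm_pow]
        gcongr
        exact Finset.mem_range_succ_iff.mp hi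
    _ = (∑ i ∈ Finset.range (m + 1), ‖c i‖) * ‖w‖ ^ m := (Finset.sum_mul ..).symm

/-- The roots of a family of polynomials with continuous coefficients and nonvanishing leading
coefficient, parametrised by a compact space, form a compact space. -/
theorem isCompact_setOf_sum_mul_pow_eq_zero {T K : Type*} [TopologicalSpace T] [CompactSpace T]
    [NormedField K] [ProperSpace K] {n : ℕ} {c : ℕ → T → K} (hc : ∀ i, Continuous (c i))
    (hn : ∀ t, c n t ≠ 0) :
    IsCompact {e : T × K | ∑ i ∈ Finset.range (n + 1), c i e.1 * e.2 ^ i = 0} := by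
  have hbound : Continuous fun t ↦ max 1 ((∑ i ∈ Finset.range n, ‖c i t‖) / ‖c n t‖) :=
    continuous_const.max <| (continuous_finsetSum _ fun i _ ↦ (hc i).norm).div (hc n).norm
      fun t ↦ norm_ne_zero_iff.mpr (hn t)
  obtain ⟨R, hR⟩ := isCompact_univ.bddAbove_image hbound.continuousOn
  refine (isCompact_univ.prod (isCompact_closedBall (0 : K) R)).of_isClosed_subset
    (isClosed_eq (by fun_prop) continuous_const) fun e he ↦ ⟨trivial, ?_⟩
  exact mem_closedBall_zero_iff.mpr <|
    (norm_le_max_of_sum_mul_pow_eq_zero (c := fun i ↦ c i e.1) (hn _) he).trans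
      (hR ⟨e.1, trivial, rfl⟩)


/-- **Existence and uniqueness of continuation of a branch sheet along a path
avoiding the singular set.**
If `γ : [0,1] → ℂ` is a continuous path avoiding the singular set `S` of `f`, and
`w₀` is a root of `f(γ 0, ·)`, then there is a unique continuous `w : [0,1] → ℂ`
with `w 0 = w₀` and `f(γ t, w t) = 0` for all `t`. -/
theorem unique_continuation_along_path
    (n : ℕ) (hn : 1 ≤ n) (a : ℕ → Polynomial ℂ)
    (f fw : ℂ → ℂ → ℂ)
    (hf : ∀ z w : ℂ, f z w = ∑ i ∈ Finset.range (n + 1), (a i).eval z * w ^ i)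
    (hfw : ∀ z w : ℂ, fw z w = ∑ i ∈ Finset.range (n + 1), (a i).eval z * (i : ℂ) * w ^ (i - 1))
    (S : Set ℂ)
    (hS : S = {z : ℂ | (a n).eval z = 0 ∨ ∃ u : ℂ, f z u = 0 ∧ fw z u = 0})
    (γ : unitInterval → ℂ) (hγ : Continuous γ) (hγS : ∀ t, γ t ∉ S)
    (w₀ : ℂ) (hw₀ : f (γ 0) w₀ = 0) :
    ∃! w : unitInterval → ℂ,
      Continuous w ∧ w 0 = w₀ ∧ ∀ t, f (γ t) (w t) = 0 := by
  have hf' (u : ℂ × ℂ) : f u.1 u.2 = ∑ i ∈ Finset.range (n + 1), (a i).eval u.1 * u.2 ^ i := hf _ _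
  have hfd : ContDiff ℂ 1 fun u : ℂ × ℂ ↦ f u.1 u.2 := by
    simp only [hf']
    exact ContDiff.sum fun i _ ↦ (((a i).contDiff_aeval 1).comp contDiff_fst).mul (contDiff_snd.pow i)
  have hlead (t) : (a n).eval (γ t) ≠ 0 := fun h ↦ hγS t (hS ▸ .inl h)
  have hinv (t : unitInterval) (w : ℂ) (h : f (γ t) w = 0) :
      (fderiv ℂ (fun u : ℂ × ℂ ↦ f u.1 u.2) (γ t, w) ∘L .inr ℂ ℂ ℂ).IsInvertible := by
    have hne : fw (γ t) w ≠ 0 := fun h' ↦ hγS t (hS ▸ .inr ⟨w, h, h'⟩)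
    have hw : HasDerivAt (f (γ t)) (fw (γ t) w) w := by
      rw [hfw, funext (hf (γ t))]
      simp only [mul_assoc]
      exact HasDerivAt.fun_sum fun i _ ↦ (hasDerivAt_pow i w).const_mul _
    have hcomp : HasFDerivAt (f (γ t))
        (fderiv ℂ (fun u : ℂ × ℂ ↦ f u.1 u.2) (γ t, w) ∘L .inr ℂ ℂ ℂ) w :=
      (hfd.differentiable one_ne_zero _).hasFDerivAt.comp w (hasFDerivAt_prodMk_right (γ t) w)
    rw [hcomp.unique hw.hasFDerivAt]
    exact ⟨.unitsEquivAut ℂ (.mk0 _ hne), by ext; simp⟩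
  have : CompactSpace {e : unitInterval × ℂ // f (γ e.1) e.2 = 0} := by
    suffices IsCompact {e : unitInterval × ℂ | f (γ e.1) e.2 = 0} from
      isCompact_iff_compactSpace.mp this
    simp only [hf]
    exact isCompact_setOf_sum_mul_pow_eq_zero (c := fun i t ↦ (a i).eval (γ t))
      (fun i ↦ (a i).continuous.comp hγ) hlead
  have cov := isLocalHomeomorph_iff_isCoveringMap.mp (isLocalHomeomorph_fst_zeroLocus hfd hγ hinv)
  let e₀ : {e : unitInterval × ℂ // f (γ e.1) e.2 = 0} := ⟨(0, w₀), hw₀⟩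
  obtain ⟨Γ, hΓ, hΓ₀⟩ := cov.exists_path_lifts (.id _) e₀ rfl
  have hΓt (t) : (Γ t).1.1 = t := congrFun hΓ t
  refine ⟨fun t ↦ (Γ t).1.2, ⟨by fun_prop, by simp [hΓ₀, e₀], fun t ↦ ?_⟩, ?_⟩
  · simpa only [hΓt] using (Γ t).2
  · rintro w ⟨hw, hw0, hwf⟩
    have heq := cov.eq_of_comp_eq (g₁ := fun t ↦ ⟨(t, w t), hwf t⟩) (g₂ := Γ)
      (by fun_prop) Γ.continuous (funext fun t ↦ (hΓt t).symm) 0 (by simp [hΓ₀, e₀, hw0])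
    exact funext fun t ↦ congrArg (fun e ↦ e.1.2) (congrFun heq t)
end

section
/- Let f(z,w) = a₀(z) + a₁(z)w + ⋯ + aₙ(z)wⁿ with polynomial coefficients aᵢ and n ≥ 1, and let S be the singular set of f. Let γ : [0,1] → ℂ be a continuous closed path (γ(1) = γ(0)) avoiding S. For each root w₀ of f(γ(0),·), let L(w₀) = w(1), where w is the unique continuous lift with w(0) = w₀ and f(γ(t), w(t)) = 0 for all t. Then L is a bijection (a permutation) of the set of roots of f(γ(0),·) onto itself. (The monodromy around a closed loop permutes the branch sheets.) -/
/-- Difference quotient of `w ↦ ∑ i ≤ n, c i * w ^ i`, as a polynomial expression in `x` and `y`. -/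
def sumPowDiffQuot (n : ℕ) (c : ℕ → ℂ) (x y : ℂ) : ℂ :=
  ∑ i ∈ Finset.range (n + 1), c i * ∑ j ∈ Finset.range i, x ^ j * y ^ (i - 1 - j)

lemma sumPowDiffQuot_mul_sub (n : ℕ) (c : ℕ → ℂ) (x y : ℂ) :
    sumPowDiffQuot n c x y * (x - y) =
      ∑ i ∈ Finset.range (n + 1), c i * x ^ i - ∑ i ∈ Finset.range (n + 1), c i * y ^ i := by
  simp only [sumPowDiffQuot, Finset.sum_mul, mul_assoc, ← Finset.sum_sub_distrib, ← mul_sub]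
  refine Finset.sum_congr rfl fun i _ => ?_
  rw [← geom_sum₂_mul, Finset.sum_mul]
  simp only [mul_assoc]

lemma sumPowDiffQuot_self (n : ℕ) (c : ℕ → ℂ) (x : ℂ) :
    sumPowDiffQuot n c x x = ∑ i ∈ Finset.range (n + 1), c i * (i : ℂ) * x ^ (i - 1) := by
  simp only [sumPowDiffQuot, geom_sum₂_self, mul_assoc]

/-- A polynomial expression with nonzero leading coefficient has finitely many roots. -/
lemma finite_setOf_sum_pow_eq_zero (n : ℕ) (c : ℕ → ℂ) (hc : c n ≠ 0) :
    {u : ℂ | ∑ i ∈ Finset.range (n + 1), c i * u ^ i = 0}.Finite := by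
  set p : Polynomial ℂ :=
    ∑ i ∈ Finset.range (n + 1), Polynomial.C (c i) * Polynomial.X ^ i with hp
  have hp0 : p ≠ 0 := fun h => hc <| by
    simpa [hp, Polynomial.finsetSum_coeff, Polynomial.coeff_X_pow] using
      congrArg (fun q : Polynomial ℂ => q.coeff n) h
  refine (Polynomial.finite_setOfPred_isRoot hp0).subset fun u hu => ?_
  simpa [hp, Polynomial.eval_finsetSum] using hu

/-- Two continuous families of simple roots of a continuously varying polynomial over a
preconnected space which agree at one point agree everywhere. -/
lemma continuous_roots_eq_of_eq {T : Type*} [TopologicalSpace T] [PreconnectedSpace T]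
    (n : ℕ) (c : T → ℕ → ℂ) (hc : ∀ i, Continuous fun t => c t i) {v w : T → ℂ}
    (hv : Continuous v) (hw : Continuous w)
    (hv0 : ∀ t, ∑ i ∈ Finset.range (n + 1), c t i * v t ^ i = 0)
    (hw0 : ∀ t, ∑ i ∈ Finset.range (n + 1), c t i * w t ^ i = 0)
    (hsimple : ∀ t, ∑ i ∈ Finset.range (n + 1), c t i * (i : ℂ) * v t ^ (i - 1) ≠ 0)
    {t₀ : T} (h₀ : v t₀ = w t₀) : v = w := by
  have hcont : Continuous fun t => sumPowDiffQuot n (c t) (v t) (w t) := by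
    unfold sumPowDiffQuot
    fun_prop
  have hopen : IsOpen {t | v t = w t} := by
    refine isOpen_iff_mem_nhds.2 fun s hs => ?_
    have hs' : v s = w s := hs
    have hne : sumPowDiffQuot n (c s) (v s) (w s) ≠ 0 := by
      rw [← hs', sumPowDiffQuot_self]
      exact hsimple s
    filter_upwards [hcont.continuousAt.eventually_ne hne] with t ht
    have h := sumPowDiffQuot_mul_sub n (c t) (v t) (w t)
    rw [hv0, hw0, sub_zero] at h
    exact sub_eq_zero.1 ((mul_eq_zero.1 h).resolve_left ht)
  have huniv := IsClopen.eq_univ ⟨isClosed_eq hv hw, hopen⟩ ⟨t₀, h₀⟩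
  exact funext fun t => Set.eq_univ_iff_forall.1 huniv t


/-- **Monodromy around a closed loop permutes the branch sheets.**
Let `γ : [0,1] → ℂ` be a continuous closed path avoiding the singular set `S` of `f`.
If `L` sends each root `w₀` of `f(γ 0, ·)` to `w 1`, where `w` is a continuous lift
with `w 0 = w₀` and `f(γ t, w t) = 0` for all `t`, then `L` is a bijection of the
set of roots of `f(γ 0, ·)` onto itself. -/
theorem monodromy_permutes_sheets
    (n : ℕ) (hn : 1 ≤ n) (a : ℕ → Polynomial ℂ)
    (f fw : ℂ → ℂ → ℂ)
    (hf : ∀ z w : ℂ, f z w = ∑ i ∈ Finset.range (n + 1), (a i).eval z * w ^ i)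
    (hfw : ∀ z w : ℂ, fw z w = ∑ i ∈ Finset.range (n + 1), (a i).eval z * (i : ℂ) * w ^ (i - 1))
    (S : Set ℂ)
    (hS : S = {z : ℂ | (a n).eval z = 0 ∨ ∃ u : ℂ, f z u = 0 ∧ fw z u = 0})
    (γ : unitInterval → ℂ) (hγ : Continuous γ) (hclosed : γ 1 = γ 0)
    (hγS : ∀ t, γ t ∉ S)
    (L : ℂ → ℂ)
    (hL : ∀ w₀ : ℂ, f (γ 0) w₀ = 0 →
      ∃ w : unitInterval → ℂ, Continuous w ∧ w 0 = w₀ ∧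
        (∀ t, f (γ t) (w t) = 0) ∧ L w₀ = w 1) :
    Set.BijOn L {u : ℂ | f (γ 0) u = 0} {u : ℂ | f (γ 0) u = 0} := by
  subst hS
  have hlead : ∀ t, (a n).eval (γ t) ≠ 0 := fun t h => hγS t (Or.inl h)
  have hsimple : ∀ t u, f (γ t) u = 0 → fw (γ t) u ≠ 0 :=
    fun t u h h' => hγS t (Or.inr ⟨u, h, h'⟩)
  have hfin : {u : ℂ | f (γ 0) u = 0}.Finite := by
    simp only [hf]
    exact finite_setOf_sum_pow_eq_zero n (fun i => (a i).eval (γ 0)) (hlead 0)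
  have hmaps : Set.MapsTo L {u : ℂ | f (γ 0) u = 0} {u : ℂ | f (γ 0) u = 0} := by
    intro u hu
    obtain ⟨w, -, -, hw, hLw⟩ := hL u hu
    simpa only [Set.mem_ofPred_eq, hLw, hclosed] using hw 1
  refine (hfin.injOn_iff_bijOn_of_mapsTo hmaps).1 fun x hx y hy hxy => ?_
  obtain ⟨v, hv, hv0, hvf, hLv⟩ := hL x hx
  obtain ⟨w, hw, hw0, hwf, hLw⟩ := hL y hy
  have hvw : v = w := by
    refine continuous_roots_eq_of_eq n (fun t i => (a i).eval (γ t))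
      (fun i => (a i).continuous.comp hγ) hv hw (fun t => ?_) (fun t => ?_) (fun t => ?_)
      (t₀ := 1) (by rw [← hLv, ← hLw, hxy])
    · rw [← hf, hvf]
    · rw [← hf, hwf]
    · rw [← hfw]
      exact hsimple t _ (hvf t)
  rw [← hv0, ← hw0, hvw]
end

section
/- Let f(z,w) = a₀(z) + a₁(z)w + ⋯ + aₙ(z)wⁿ with polynomial coefficients aᵢ and n ≥ 1, and let S be the singular set of f. Let U ⊆ ℂ be an open, connected, simply connected set with U ∩ S = ∅, let z₀ ∈ U, and let w₀ be a root of f(z₀,·). Then there exists a unique function g analytic on U with g(z₀) = w₀ and f(z, g(z)) = 0 for all z ∈ U. (A branch sheet extends analytically and single-valuedly over any simply connected region containing no singular points.) -/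
open Filter Topology

/-- The part over `U` of the zero locus of a function of two complex variables. -/
abbrev ZeroLocusOver (F : ℂ × ℂ → ℂ) (U : Set ℂ) : Type :=
  {p : U × ℂ // F (p.1, p.2) = 0}

/-- The projection of the zero locus to the base. -/
def ZeroLocusOver.proj (F : ℂ × ℂ → ℂ) (U : Set ℂ) (p : ZeroLocusOver F U) : U :=
  p.1.1

/-- `ψ` solves `F (z, ψ z) = 0` locally at `u`, with no other solutions near `u`. -/
structure IsLocalSolution (F : ℂ × ℂ → ℂ) (u : ℂ × ℂ) (ψ : ℂ → ℂ) : Prop where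
  differentiableAt : DifferentiableAt ℂ ψ u.1
  apply_fst : ψ u.1 = u.2
  eventually_iff : ∀ᶠ v in 𝓝 u, F v = 0 ↔ ψ v.1 = v.2

theorem HasStrictFDerivAt.exists_isLocalSolution {F : ℂ × ℂ → ℂ} {u : ℂ × ℂ}
    {F' : ℂ × ℂ →L[ℂ] ℂ} (hF : HasStrictFDerivAt F F' u) (hu : F u = 0)
    (hF' : F' (0, 1) ≠ 0) : ∃ ψ, IsLocalSolution F u ψ := by
  have hinv : (F' ∘L .inr ℂ ℂ ℂ).IsInvertible := by
    refine ⟨ContinuousLinearEquiv.unitsEquivAut ℂ (Units.mk0 _ hF'), ?_⟩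
    ext
    simp
  have hiff := hF.eventually_apply_eq_iff_implicitFunctionOfProdDomain hinv
  refine ⟨hF.implicitFunctionOfProdDomain hinv,
    (hF.hasStrictFDerivAt_implicitFunctionOfProdDomain hinv).differentiableAt,
    hiff.self_of_nhds.mp rfl, ?_⟩
  simpa only [hu] using hiff

namespace IsLocalSolution

variable {F : ℂ × ℂ → ℂ} {u : ℂ × ℂ} {ψ : ℂ → ℂ}

theorem tendsto_graph (h : IsLocalSolution F u ψ) :
    Tendsto (fun z ↦ (z, ψ z)) (𝓝 u.1) (𝓝 u) := by
  have := continuousAt_id.prodMk h.differentiableAt.continuousAt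
  simpa [ContinuousAt, h.apply_fst] using this

theorem eventually_eq_zero (h : IsLocalSolution F u ψ) :
    ∀ᶠ z in 𝓝 u.1, F (z, ψ z) = 0 :=
  (h.tendsto_graph.eventually h.eventually_iff).mono fun _ hz ↦ hz.mpr rfl

/-- A continuous solution through `u` agrees with the local solution at `u`. -/
theorem differentiableAt_of_continuousAt {z : ℂ} {g : ℂ → ℂ}
    (h : IsLocalSolution F (z, g z) ψ) (hg : ContinuousAt g z)
    (hzero : ∀ᶠ x in 𝓝 z, F (x, g x) = 0) : DifferentiableAt ℂ g z := by
  refine h.differentiableAt.congr_of_eventuallyEq ?_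
  have := (continuousAt_id.prodMk hg).eventually h.eventually_iff
  filter_upwards [this, hzero] with x hx hx0
  exact (hx.mp hx0).symm

end IsLocalSolution

namespace ZeroLocusOver

variable {F : ℂ × ℂ → ℂ} {U : Set ℂ}

theorem continuous_proj : Continuous (proj F U) :=
  continuous_fst.comp continuous_subtype_val

theorem continuous_toProd :
    Continuous fun p : ZeroLocusOver F U ↦ ((p.1.1 : ℂ), p.1.2) := by
  fun_prop

theorem isOpenMap_proj
    (hloc : ∀ u : ℂ × ℂ, u.1 ∈ U → F u = 0 → ∃ ψ, IsLocalSolution F u ψ) :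
    IsOpenMap (proj F U) := by
  refine IsOpenMap.of_nhds_le fun p A hA ↦ ?_
  obtain ⟨ψ, hψ⟩ := hloc (p.1.1, p.1.2) p.1.1.2 p.2
  have hA : proj F U ⁻¹' A ∈ 𝓝 p := hA
  have hind : IsInducing fun p : ZeroLocusOver F U ↦ ((p.1.1 : ℂ), p.1.2) :=
    (IsInducing.subtypeVal.prodMap IsInducing.id).comp IsInducing.subtypeVal
  rw [hind.nhds_eq_comap, mem_comap] at hA
  obtain ⟨t, ht, htA⟩ := hA
  have hev := (hψ.tendsto_graph.eventually ht).and hψ.eventually_eq_zero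
  filter_upwards [continuous_subtype_val.continuousAt.eventually hev] with z hz
  exact htA (a := ⟨(z, ψ z), hz.2⟩) hz.1

theorem isLocalHomeomorph_proj
    (hloc : ∀ u : ℂ × ℂ, u.1 ∈ U → F u = 0 → ∃ ψ, IsLocalSolution F u ψ) :
    IsLocalHomeomorph (proj F U) := by
  rw [isLocalHomeomorph_iff_isOpenEmbedding_restrict]
  intro p
  obtain ⟨ψ, hψ⟩ := hloc (p.1.1, p.1.2) p.1.1.2 p.2
  obtain ⟨V, hV, hVo, hpV⟩ := eventually_nhds_iff.mp
    (continuous_toProd.continuousAt.eventually hψ.eventually_iff)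
  refine ⟨V, hVo.mem_nhds hpV, .of_continuous_injective_isOpenMap
    (continuous_proj.comp continuous_subtype_val) ?_
    ((isOpenMap_proj hloc).domRestrict hVo)⟩
  rintro ⟨⟨⟨x, w⟩, h⟩, hq⟩ ⟨⟨⟨y, w'⟩, h'⟩, hq'⟩ (rfl : x = y)
  have : w = w' := ((hV _ hq).mp h).symm.trans ((hV _ hq').mp h')
  subst this
  rfl

theorem isProperMap_proj (hU : IsOpen U) (hF : Continuous F) {B : ℂ → ℝ}
    (hB : ContinuousOn B U) (hbd : ∀ z ∈ U, ∀ w, F (z, w) = 0 → ‖w‖ ≤ B z) :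
    IsProperMap (proj F U) := by
  have := hU.locallyCompactSpace
  refine isProperMap_iff_isCompact_preimage.mpr ⟨continuous_proj, fun K hK ↦ ?_⟩
  obtain ⟨R, hR⟩ := hK.bddAbove_image (continuousOn_iff_continuous_domRestrict.mp hB).continuousOn
  have hcl : IsClosed {p : U × ℂ | F (p.1, p.2) = 0} :=
    isClosed_eq (hF.comp (by fun_prop)) continuous_const
  have hc := hcl.isClosedEmbedding_subtypeVal.isCompact_preimage
    (hK.prod (isCompact_closedBall (0 : ℂ) R))
  refine hc.of_isClosed_subset (hK.isClosed.preimage continuous_proj) fun p hp ↦ ⟨hp, ?_⟩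
  rw [mem_closedBall_zero_iff]
  exact (hbd _ p.1.1.2 _ p.2).trans (hR ⟨_, hp, rfl⟩)

theorem isCoveringMap_proj (hU : IsOpen U) (hF : Continuous F)
    (hloc : ∀ u : ℂ × ℂ, u.1 ∈ U → F u = 0 → ∃ ψ, IsLocalSolution F u ψ) {B : ℂ → ℝ}
    (hB : ContinuousOn B U) (hbd : ∀ z ∈ U, ∀ w, F (z, w) = 0 → ‖w‖ ≤ B z) :
    IsCoveringMap (proj F U) := by
  have hprop := isProperMap_proj hU hF hB hbd
  have hlh := isLocalHomeomorph_proj hloc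
  rw [isCoveringMap_iff_isCoveringMapOn_univ]
  refine hprop.isClosedMap.isCoveringMapOn_of_isLocalHomeomorphOn (fun x _ ↦ ?_)
    hlh.isLocalHomeomorphOn
  refine (hprop.isCompact_preimage isCompact_singleton).finite
    (.of_openPartialHomeomorph _ subset_rfl fun e _ ↦ ?_)
  obtain ⟨φ, hφ, h⟩ := hlh e
  exact ⟨φ, hφ, h.symm⟩

end ZeroLocusOver

theorem exists_eqOn_solution_of_isSimplyConnected {F : ℂ × ℂ → ℂ} {U : Set ℂ}
    (hU : IsOpen U) (hUsc : IsSimplyConnected U) (hF : Continuous F)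
    (hloc : ∀ u : ℂ × ℂ, u.1 ∈ U → F u = 0 → ∃ ψ, IsLocalSolution F u ψ) {B : ℂ → ℝ}
    (hB : ContinuousOn B U) (hbd : ∀ z ∈ U, ∀ w, F (z, w) = 0 → ‖w‖ ≤ B z)
    {z₀ w₀ : ℂ} (hz₀ : z₀ ∈ U) (hw₀ : F (z₀, w₀) = 0) :
    ∃ g : ℂ → ℂ,
      (DifferentiableOn ℂ g U ∧ g z₀ = w₀ ∧ ∀ z ∈ U, F (z, g z) = 0) ∧
      ∀ g' : ℂ → ℂ,
        (DifferentiableOn ℂ g' U ∧ g' z₀ = w₀ ∧ ∀ z ∈ U, F (z, g' z) = 0) →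
        Set.EqOn g g' U := by
  classical
  have := hUsc.simplyConnectedSpace
  have := hU.locallyPathConnectedSpace
  obtain ⟨s, ⟨hs₀, hs⟩, huniq⟩ :=
    (ZeroLocusOver.isCoveringMap_proj hU hF hloc hB hbd).existsUnique_continuousMap_lifts
      (.id U) ⟨z₀, hz₀⟩ ⟨(⟨z₀, hz₀⟩, w₀), hw₀⟩ rfl
  obtain ⟨g, hg⟩ : ∃ g : ℂ → ℂ, ∀ z : U, g z = (s z).1.2 :=
    ⟨fun z ↦ if hz : z ∈ U then (s ⟨z, hz⟩).1.2 else 0, by simp⟩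
  have hzero : ∀ z ∈ U, F (z, g z) = 0 := fun z hz ↦ by
    have h1 : (s ⟨z, hz⟩).1.1 = ⟨z, hz⟩ := congrFun hs ⟨z, hz⟩
    simpa [hg ⟨z, hz⟩, h1] using (s ⟨z, hz⟩).2
  have hcont : ContinuousOn g U := by
    rw [continuousOn_iff_continuous_domRestrict]
    have : Continuous fun z ↦ (s z).1.2 := by fun_prop
    exact this.congr fun z ↦ (hg z).symm
  refine ⟨g, ⟨fun z hz ↦ ?_, ?_, hzero⟩, fun g' ⟨hd, h0, hz'⟩ z hz ↦ ?_⟩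
  · obtain ⟨ψ, hψ⟩ := hloc (z, g z) hz (hzero z hz)
    exact (hψ.differentiableAt_of_continuousAt (hcont.continuousAt (hU.mem_nhds hz))
      (eventually_of_mem (hU.mem_nhds hz) hzero)).differentiableWithinAt
  · rw [hg ⟨z₀, hz₀⟩, hs₀]
  · have hc : Continuous fun x : U ↦ g' x :=
      continuousOn_iff_continuous_domRestrict.mp hd.continuousOn
    have h := huniq ⟨fun x ↦ ⟨(x, g' x), hz' x x.2⟩, (continuous_id.prodMk hc).subtype_mk _⟩
      ⟨Subtype.ext (Prod.ext rfl h0), rfl⟩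
    rw [hg ⟨z, hz⟩, ← h]
    rfl

/-- Cauchy's bound for the roots of a polynomial with nonzero leading coefficient. -/
theorem norm_le_one_add_sum_of_sum_eq_zero {n : ℕ} (hn : 1 ≤ n) {c : ℕ → ℂ} (hc : c n ≠ 0)
    {w : ℂ} (hw : ∑ i ∈ Finset.range (n + 1), c i * w ^ i = 0) :
    ‖w‖ ≤ 1 + ∑ i ∈ Finset.range n, ‖c i‖ / ‖c n‖ := by
  have hsum : 0 ≤ ∑ i ∈ Finset.range n, ‖c i‖ / ‖c n‖ := by positivity
  rcases le_total ‖w‖ 1 with h1 | h1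
  · linarith
  have hcn : 0 < ‖c n‖ := norm_pos_iff.mpr hc
  obtain ⟨m, rfl⟩ : ∃ m, n = m + 1 := ⟨n - 1, by omega⟩
  rw [Finset.sum_range_succ, add_comm, add_eq_zero_iff_eq_neg] at hw
  have key : ‖c (m + 1)‖ * ‖w‖ * ‖w‖ ^ m ≤ (∑ i ∈ Finset.range (m + 1), ‖c i‖) * ‖w‖ ^ m := by
    calc ‖c (m + 1)‖ * ‖w‖ * ‖w‖ ^ m = ‖c (m + 1) * w ^ (m + 1)‖ := by
          rw [norm_mul, norm_pow]; ring
      _ = ‖∑ i ∈ Finset.range (m + 1), c i * w ^ i‖ := by rw [hw, norm_neg]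
      _ ≤ ∑ i ∈ Finset.range (m + 1), ‖c i * w ^ i‖ := norm_sum_le _ _
      _ ≤ ∑ i ∈ Finset.range (m + 1), ‖c i‖ * ‖w‖ ^ m := by
          refine Finset.sum_le_sum fun i hi ↦ ?_
          rw [norm_mul, norm_pow]
          gcongr
          exact Nat.lt_succ_iff.mp (Finset.mem_range.mp hi)
      _ = _ := (Finset.sum_mul ..).symm
  have := le_of_mul_le_mul_right key (by positivity)
  rw [← Finset.sum_div]
  have : ‖w‖ ≤ (∑ i ∈ Finset.range (m + 1), ‖c i‖) / ‖c (m + 1)‖ := by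
    rw [le_div_iff₀ hcn]; linarith
  linarith


/-- **A branch sheet extends single-valuedly over any simply connected region
containing no singular points.**
If `U` is open, connected and simply connected with `U ∩ S = ∅`, `z₀ ∈ U` and
`w₀` is a root of `f(z₀,·)`, then there is a function `g` analytic on `U` with
`g z₀ = w₀` and `f(z, g z) = 0` on `U`, and `g` is unique on `U` among such
functions. -/
theorem branch_over_simply_connected_region
    (n : ℕ) (hn : 1 ≤ n) (a : ℕ → Polynomial ℂ)
    (f fw : ℂ → ℂ → ℂ)
    (hf : ∀ z w : ℂ, f z w = ∑ i ∈ Finset.range (n + 1), (a i).eval z * w ^ i)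
    (hfw : ∀ z w : ℂ, fw z w = ∑ i ∈ Finset.range (n + 1), (a i).eval z * (i : ℂ) * w ^ (i - 1))
    (S : Set ℂ)
    (hS : S = {z : ℂ | (a n).eval z = 0 ∨ ∃ u : ℂ, f z u = 0 ∧ fw z u = 0})
    (U : Set ℂ) (hUopen : IsOpen U) (hUconn : IsConnected U)
    (hUsc : SimplyConnectedSpace U) (hUS : U ∩ S = ∅)
    (z₀ : ℂ) (hz₀ : z₀ ∈ U) (w₀ : ℂ) (hw₀ : f z₀ w₀ = 0) :
    ∃ g : ℂ → ℂ,
      (DifferentiableOn ℂ g U ∧ g z₀ = w₀ ∧ ∀ z ∈ U, f z (g z) = 0) ∧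
      ∀ g' : ℂ → ℂ,
        (DifferentiableOn ℂ g' U ∧ g' z₀ = w₀ ∧ ∀ z ∈ U, f z (g' z) = 0) →
        Set.EqOn g g' U := by
  obtain rfl : f = fun z w ↦ ∑ i ∈ Finset.range (n + 1), (a i).eval z * w ^ i :=
    funext₂ hf
  have hUS' : ∀ z ∈ U, z ∉ S := fun z hz hzS ↦
    (Set.disjoint_iff_inter_eq_empty.mpr hUS).notMem_of_mem_left hz hzS
  have han : ∀ z ∈ U, (a n).eval z ≠ 0 := fun z hz h ↦
    hUS' z hz (hS ▸ Or.inl h)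
  let F : ℂ × ℂ → ℂ := fun p ↦ ∑ i ∈ Finset.range (n + 1), (a i).eval p.1 * p.2 ^ i
  have hF : ContDiff ℂ 1 F := by
    refine ContDiff.sum fun i _ ↦ ContDiff.mul ?_ (contDiff_snd.pow i)
    simpa only [Function.comp_def, Polynomial.coe_aeval_eq_eval] using
      ((a i).contDiff_aeval (𝕜 := ℂ) 1).comp (contDiff_fst (E := ℂ) (F := ℂ))
  refine exists_eqOn_solution_of_isSimplyConnected (F := F) hUopen hUsc hF.continuous
    (fun u hu hu0 ↦ ?_) (B := fun z ↦ 1 + ∑ i ∈ Finset.range n, ‖(a i).eval z‖ / ‖(a n).eval z‖)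
    ?_ (fun z hz w hw ↦ norm_le_one_add_sum_of_sum_eq_zero hn (han z hz) hw) hz₀ hw₀
  · have hd : HasStrictFDerivAt F (fderiv ℂ F u) u :=
      hF.contDiffAt.hasStrictFDerivAt one_ne_zero
    refine hd.exists_isLocalSolution hu0 fun h0 ↦ hUS' u.1 hu (hS ▸ Or.inr ⟨u.2, hu0, ?_⟩)
    have h1 : HasDerivAt (fun w ↦ F (u.1, w)) (fderiv ℂ F u (0, 1)) u.2 :=
      HasFDerivAt.comp_hasDerivAt (f := fun w ↦ (u.1, w)) u.2 hd.hasFDerivAt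
        ((hasDerivAt_const _ _).prodMk (hasDerivAt_id _))
    have h2 : HasDerivAt (fun w ↦ F (u.1, w)) (fw u.1 u.2) u.2 := by
      rw [hfw]
      refine HasDerivAt.fun_sum fun i _ ↦ ?_
      rw [mul_assoc]
      exact (hasDerivAt_pow i u.2).const_mul ((a i).eval u.1)
    rw [h2.unique h1, h0]
  · refine continuousOn_const.add (continuousOn_finsetSum _ fun i _ ↦ ?_)
    exact (a i).continuous.norm.continuousOn.div (a n).continuous.norm.continuousOn
      fun z hz ↦ norm_ne_zero_iff.mpr (han z hz)
end
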